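/- arXiv:1911.06417 — 2 statements merged into one kernel-verified Lean document; each statement's English description precedes it below -/
import Mathlib

section
/- Let I ⊆ S be a squarefree monomial ideal with minimal primary decomposition I = I_{α_1} ∩ ⋯ ∩ I_{α_r} satisfying I_{α_1} + ⋯ + I_{α_r} = (x_1,…,x_n). Let e ≥ 2, q = p^e, and suppose J_q ≠ 0. If no minimal monomial generator of J_q is contained in L_e, then the minimal number of generators of the S-module (I^{[q]} :_S I)/(L_e + I^{[q]}) equals μ_S(J_q), the minimal number of generators of the monomial ideal J_q. -/
noncomputable section

/-- The `q`-th Frobenius power of an ideal: the ideal generated by `{f^q : f ∈ I}`. -/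
def frobPow {R : Type*} [CommRing R] (q : ℕ) (I : Ideal R) : Ideal R :=
  Ideal.span ((fun f => f ^ q) '' (I : Set R))

/-- The monomial `x^γ = x_1^{γ_1} ⋯ x_n^{γ_n}` in `k[[x_1,…,x_n]]`. -/
def mon (k : Type*) [Field k] {n : ℕ} (γ : Fin n → ℕ) : MvPowerSeries (Fin n) k :=
  ∏ i, (MvPowerSeries.X i : MvPowerSeries (Fin n) k) ^ γ i

/-- The face ideal `I_α`, generated by the variables `x_i` with `α i = 1`. -/
def faceIdeal (k : Type*) [Field k] {n : ℕ} (α : Fin n → ℕ) :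
    Ideal (MvPowerSeries (Fin n) k) :=
  Ideal.span {f | ∃ i, α i = 1 ∧ f = MvPowerSeries.X i}

/-- `I = I_{α_1} ∩ ⋯ ∩ I_{α_r}` is the minimal primary decomposition of the squarefree
monomial ideal `I` into face ideals: each `α j` is a nonzero `{0,1}`-vector, `I` is the
intersection of the face ideals `I_{α j}`, and the decomposition is irredundant (the
supports of the `α j` are pairwise incomparable). -/
def IsMinFaceDecomp (k : Type*) [Field k] {n r : ℕ} (α : Fin r → Fin n → ℕ)
    (I : Ideal (MvPowerSeries (Fin n) k)) : Prop :=
  (∀ j i, α j i = 0 ∨ α j i = 1) ∧ (∀ j, α j ≠ 0) ∧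
    I = ⨅ j, faceIdeal k (α j) ∧
    ∀ j l, j ≠ l → ¬ ({i | α j i = 1} ⊆ {i | α l i = 1})

/-- `x^γ` is a minimal monomial generator of the monomial ideal `J`: `x^γ ∈ J` and no
monomial properly dividing `x^γ` belongs to `J`. -/
def IsMinGen (k : Type*) [Field k] {n : ℕ} (J : Ideal (MvPowerSeries (Fin n) k))
    (γ : Fin n → ℕ) : Prop :=
  mon k γ ∈ J ∧ ∀ δ : Fin n → ℕ, (∀ i, δ i ≤ γ i) → δ ≠ γ → mon k δ ∉ J

/-- `J_q`: the unique minimal monomial ideal with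
`(I^{[q]} :_S I) = I^{[q]} + J_q + ((x_1⋯x_n)^{q-1})`; equivalently, the ideal generated by
those minimal monomial generators of `(I^{[q]} :_S I)` lying neither in `I^{[q]}` nor in
the principal ideal `((x_1⋯x_n)^{q-1})`. -/
def Jideal (k : Type*) [Field k] {n : ℕ} (q : ℕ) (I : Ideal (MvPowerSeries (Fin n) k)) :
    Ideal (MvPowerSeries (Fin n) k) :=
  Ideal.span (mon k '' {γ | IsMinGen k ((frobPow q I).colon I) γ ∧
    mon k γ ∉ frobPow q I ∧ mon k γ ∉ Ideal.span {mon k (fun _ => 1) ^ (q - 1)}})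

/-- `L_e = Σ K_{β_1}·K_{β_2}^{[p^{β_1}]} ⋯ K_{β_s}^{[p^{β_1+⋯+β_{s-1}}]}`, the sum over all
`s ≥ 2` and all `1 ≤ β_1,…,β_s < e` with `β_1 + ⋯ + β_s = e`, where `K_a = (I^{[p^a]} :_S I)`. -/
def Lideal {R : Type*} [CommRing R] (p e : ℕ) (I : Ideal R) : Ideal R :=
  ⨆ (s : ℕ) (_ : 2 ≤ s) (β : Fin s → ℕ)
    (_ : (∀ i, 1 ≤ β i ∧ β i < e) ∧ ∑ i, β i = e),
    ∏ i, frobPow (p ^ (∑ j ∈ Finset.Iio i, β j)) ((frobPow (p ^ β i) I).colon I)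

/-- The minimal number of generators of the quotient module `A/B` (for ideals `B ≤ A`):
the least cardinality of a finite set `s` with `A = B + (s)`. -/
noncomputable def muQuot {R : Type*} [CommRing R] (A B : Ideal R) : ℕ :=
  sInf {c | ∃ s : Finset R, s.card = c ∧ A = B ⊔ Ideal.span (s : Set R)}

/-- The minimal number of generators of an ideal. -/
noncomputable def muIdeal {R : Type*} [CommRing R] (J : Ideal R) : ℕ :=
  sInf {c | ∃ s : Finset R, s.card = c ∧ Ideal.span (s : Set R) = J}

section Frobenius

variable {R : Type*} [CommRing R] (p : ℕ)

theorem frobPow_one (I : Ideal R) : frobPow 1 I = I := by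
  simp [frobPow]

theorem colon_mul_frobPow_colon_le_Lideal {e : ℕ} (he : 2 ≤ e) (I : Ideal R) :
    (frobPow (p ^ 1) I).colon (I : Set R) *
        frobPow (p ^ 1) ((frobPow (p ^ (e - 1)) I).colon (I : Set R)) ≤ Lideal p e I := by
  have hβ : (∀ i, 1 ≤ ![1, e - 1] i ∧ ![1, e - 1] i < e) ∧ ∑ i, ![1, e - 1] i = e := by
    simp [Fin.forall_fin_two]
    omega
  refine le_trans (le_of_eq ?_) (le_iSup₂_of_le 2 le_rfl <| le_iSup₂_of_le _ hβ le_rfl)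
  have h0 : (Finset.Iio (0 : Fin 2)) = ∅ := rfl
  have h1 : (Finset.Iio (1 : Fin 2)) = {0} := rfl
  rw [Fin.prod_univ_two, h0, h1]
  simp [frobPow_one]

variable [ExpChar R p]

theorem frobPow_pow_eq_map (a : ℕ) (I : Ideal R) :
    frobPow (p ^ a) I = I.map (iterateFrobenius R p a) := rfl

theorem Ideal.le_colon_iff_mul_le {A N I : Ideal R} : A ≤ N.colon (I : Set R) ↔ A * I ≤ N := by
  rw [Ideal.mul_le]
  exact forall₂_congr fun _ _ => Submodule.mem_colon

theorem frobPow_frobPow (a b : ℕ) (I : Ideal R) :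
    frobPow (p ^ a) (frobPow (p ^ b) I) = frobPow (p ^ (a + b)) I := by
  simp only [frobPow_pow_eq_map, Ideal.map_map]
  congr 1
  ext x
  simp [iterateFrobenius_def, ← pow_mul, pow_add, mul_comm]

theorem colon_mul_frobPow_colon_le (a b : ℕ) (I : Ideal R) :
    (frobPow (p ^ a) I).colon (I : Set R) *
        frobPow (p ^ a) ((frobPow (p ^ b) I).colon (I : Set R)) ≤
      (frobPow (p ^ (a + b)) I).colon (I : Set R) := by
  have key (c : ℕ) : (frobPow (p ^ c) I).colon (I : Set R) * I ≤ frobPow (p ^ c) I :=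
    Ideal.le_colon_iff_mul_le.1 le_rfl
  rw [Ideal.le_colon_iff_mul_le, mul_right_comm, ← frobPow_frobPow]
  calc _ ≤ frobPow (p ^ a) I * frobPow (p ^ a) ((frobPow (p ^ b) I).colon (I : Set R)) :=
        Ideal.mul_mono_left (key a)
    _ = frobPow (p ^ a) (I * (frobPow (p ^ b) I).colon (I : Set R)) := by
        simp only [frobPow_pow_eq_map, Ideal.map_mul]
    _ ≤ _ := by
        rw [mul_comm I]
        simp only [frobPow_pow_eq_map p a]
        exact Ideal.map_mono (key b)

theorem prod_frobPow_colon_le (I : Ideal R) (s : ℕ) (β : Fin s → ℕ) :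
    ∏ i, frobPow (p ^ (∑ j ∈ Finset.Iio i, β j)) ((frobPow (p ^ β i) I).colon (I : Set R)) ≤
      (frobPow (p ^ (∑ i, β i)) I).colon (I : Set R) := by
  induction s with
  | zero =>
    rw [Ideal.le_colon_iff_mul_le]
    simp [frobPow_one]
  | succ s ih =>
    rw [Fin.prod_univ_castSucc, Fin.sum_univ_castSucc]
    have h (i : Fin s) : ∑ j ∈ Finset.Iio i.castSucc, β j = ∑ j ∈ Finset.Iio i, β j.castSucc := by
      rw [← Fin.map_castSuccEmb_Iio, Finset.sum_map]
      rfl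
    have hl : ∑ j ∈ Finset.Iio (Fin.last s), β j = ∑ j : Fin s, β j.castSucc := by
      rw [Fin.Iio_last_eq_map]
      simp
    simp only [h, hl]
    exact (Ideal.mul_mono_left (ih fun j => β j.castSucc)).trans
      (colon_mul_frobPow_colon_le p _ _ I)

theorem Lideal_le_colon (e : ℕ) (I : Ideal R) :
    Lideal p e I ≤ (frobPow (p ^ e) I).colon (I : Set R) := by
  simp only [Lideal, iSup_le_iff]
  rintro s - β ⟨-, rfl⟩
  exact prod_frobPow_colon_le p I s β

end Frobenius

section Monomial

open MvPowerSeries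

variable {k : Type*} [Field k] {n : ℕ}

theorem mon_eq_monomial (d : Fin n →₀ ℕ) : mon k d = monomial d (1 : k) := by
  rw [monomial_one_eq, Finsupp.prod_fintype _ _ (by simp)]
  rfl

theorem mon_mul_mon (γ δ : Fin n → ℕ) : mon k γ * mon k δ = mon k (γ + δ) := by
  simp [mon, ← Finset.prod_mul_distrib, pow_add]

theorem mon_pow (γ : Fin n → ℕ) (m : ℕ) : mon k γ ^ m = mon k (m • γ) := by
  simp [mon, ← Finset.prod_pow, ← pow_mul, mul_comm]

theorem mon_dvd_mon {γ δ : Fin n → ℕ} (h : γ ≤ δ) : mon k γ ∣ mon k δ :=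
  ⟨mon k (δ - γ), by rw [mon_mul_mon, add_tsub_cancel_of_le h]⟩

/-- An ideal of `k[[x_1,…,x_n]]` is monomial if it consists of the power series all of whose
monomials it contains. -/
def IsMonomialIdeal (J : Ideal (MvPowerSeries (Fin n) k)) : Prop :=
  ∀ f, f ∈ J ↔ ∀ d, coeff d f ≠ 0 → mon k d ∈ J

theorem exists_finset_le (U : Set (Fin n →₀ ℕ)) :
    ∃ F : Finset (Fin n →₀ ℕ), ↑F ⊆ U ∧ ∀ d ∈ U, ∃ u ∈ F, u ≤ d := by
  have hf : {u | Minimal (· ∈ U) u}.Finite :=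
    WellQuasiOrderedLE.finite_of_isAntichain (setOfPred_minimal_antichain _)
  refine ⟨hf.toFinset, fun u hu => ?_, fun d hd => ?_⟩
  · exact (hf.mem_toFinset.1 hu).prop
  · obtain ⟨u, hud, hu⟩ := exists_minimal_le_of_wellFoundedLT (· ∈ U) d hd
    exact ⟨u, hf.mem_toFinset.2 hu, hud⟩

theorem mem_span_mon_of_finset (F : Finset (Fin n →₀ ℕ)) (f : MvPowerSeries (Fin n) k)
    (hf : ∀ d, coeff d f ≠ 0 → ∃ u ∈ F, u ≤ d) :
    f ∈ Ideal.span ((fun d : Fin n →₀ ℕ => mon k d) '' F) := by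
  classical
  induction F using Finset.induction_on generalizing f with
  | empty =>
    have : f = 0 := MvPowerSeries.ext fun d => by
      by_contra h
      simpa using hf d h
    simp [this]
  | insert u F hu ih =>
    let g : MvPowerSeries (Fin n) k := fun d => coeff (d + u) f
    have hg (d) : coeff d g = coeff (d + u) f := rfl
    have hc (d) : coeff d (f - mon k u * g) = if u ≤ d then 0 else coeff d f := by
      rw [map_sub, mon_eq_monomial, coeff_monomial_mul]
      split_ifs with h
      · rw [hg, tsub_add_cancel_of_le h, one_mul, sub_self]
      · rw [sub_zero]
    rw [← sub_add_cancel f (mon k u * g)]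
    refine Ideal.add_mem _ (Ideal.span_mono (Set.image_mono (by simp)) (ih _ fun d hd => ?_))
      (Ideal.mul_mem_right _ _ (Ideal.subset_span ⟨u, by simp, rfl⟩))
    rw [hc] at hd
    split_ifs at hd with h
    · exact absurd rfl hd
    · obtain ⟨v, hv, hvd⟩ := hf d hd
      rcases Finset.mem_insert.1 hv with rfl | hv
      · exact absurd hvd h
      · exact ⟨v, hv, hvd⟩

theorem mem_span_mon_iff (U : Set (Fin n →₀ ℕ)) (f : MvPowerSeries (Fin n) k) :
    f ∈ Ideal.span ((fun d : Fin n →₀ ℕ => mon k d) '' U) ↔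
      ∀ d, coeff d f ≠ 0 → ∃ u ∈ U, u ≤ d := by
  classical
  refine ⟨fun hf => ?_, fun hf => ?_⟩
  · induction hf using Submodule.span_induction with
    | mem f hf =>
      obtain ⟨u, hu, rfl⟩ := hf
      intro d hd
      simp only [mon_eq_monomial, coeff_monomial] at hd
      exact ⟨u, hu, by grind⟩
    | zero => simp
    | add f g _ _ hf hg =>
      intro d hd
      by_cases h : coeff d f = 0
      · exact hg d fun h' => hd (by rw [map_add, h, h', add_zero])
      · exact hf d h
    | smul a f _ hf =>
      intro d hd
      rw [smul_eq_mul, coeff_mul] at hd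
      obtain ⟨x, hx, hne⟩ := Finset.exists_ne_zero_of_sum_ne_zero hd
      obtain ⟨u, hu, hux⟩ := hf x.2 (right_ne_zero_of_mul hne)
      exact ⟨u, hu, hux.trans (Finset.HasAntidiagonal.mem_antidiagonal.1 hx ▸ le_add_self)⟩
  · obtain ⟨F, hFU, hF⟩ := exists_finset_le U
    refine Ideal.span_mono (Set.image_mono hFU) (mem_span_mon_of_finset F f fun d hd => ?_)
    obtain ⟨u, hu, hud⟩ := hf d hd
    obtain ⟨v, hv, hvu⟩ := hF u hu
    exact ⟨v, hv, hvu.trans hud⟩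

theorem mon_mem_span_mon_iff (U : Set (Fin n →₀ ℕ)) (d : Fin n →₀ ℕ) :
    mon k d ∈ Ideal.span ((fun d : Fin n →₀ ℕ => mon k d) '' U) ↔ ∃ u ∈ U, u ≤ d := by
  classical
  rw [mem_span_mon_iff]
  refine ⟨fun h => h d (by simp [mon_eq_monomial]), fun h d' hd' => ?_⟩
  rw [mon_eq_monomial, coeff_monomial] at hd'
  obtain rfl : d' = d := by grind
  exact h

theorem isMonomialIdeal_span (U : Set (Fin n →₀ ℕ)) :
    IsMonomialIdeal (Ideal.span ((fun d : Fin n →₀ ℕ => mon k d) '' U)) := fun f => by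
  simp only [mem_span_mon_iff U f, mon_mem_span_mon_iff]

theorem IsMonomialIdeal.eq_span {J : Ideal (MvPowerSeries (Fin n) k)} (hJ : IsMonomialIdeal J) :
    J = Ideal.span ((fun d : Fin n →₀ ℕ => mon k d) '' {d | mon k d ∈ J}) := by
  refine le_antisymm (fun f hf => ?_) (Ideal.span_le.2 ?_)
  · rw [mem_span_mon_iff]
    exact fun d hd => ⟨d, (hJ f).1 hf d hd, le_rfl⟩
  · rintro _ ⟨d, hd, rfl⟩
    exact hd

theorem isMonomialIdeal_iff {J : Ideal (MvPowerSeries (Fin n) k)} :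
    IsMonomialIdeal J ↔ ∃ U, J = Ideal.span ((fun d : Fin n →₀ ℕ => mon k d) '' U) :=
  ⟨fun h => ⟨_, h.eq_span⟩, by rintro ⟨U, rfl⟩; exact isMonomialIdeal_span U⟩

theorem IsMonomialIdeal.iInf {ι : Sort*} {J : ι → Ideal (MvPowerSeries (Fin n) k)}
    (h : ∀ i, IsMonomialIdeal (J i)) : IsMonomialIdeal (⨅ i, J i) := fun f => by
  simp only [Submodule.mem_iInf]
  exact ⟨fun hf d hd i => (h i f).1 (hf i) d hd, fun hf i => (h i f).2 fun d hd => hf d hd i⟩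

theorem IsMonomialIdeal.iSup {ι : Sort*} {J : ι → Ideal (MvPowerSeries (Fin n) k)}
    (h : ∀ i, IsMonomialIdeal (J i)) : IsMonomialIdeal (⨆ i, J i) := by
  simp only [isMonomialIdeal_iff] at h ⊢
  choose U hU using h
  refine ⟨⋃ i, U i, ?_⟩
  rw [Set.image_iUnion, Ideal.span_iUnion]
  exact iSup_congr hU

theorem IsMonomialIdeal.mul {A B : Ideal (MvPowerSeries (Fin n) k)}
    (hA : IsMonomialIdeal A) (hB : IsMonomialIdeal B) : IsMonomialIdeal (A * B) := by
  rw [isMonomialIdeal_iff] at *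
  obtain ⟨U, rfl⟩ := hA
  obtain ⟨V, rfl⟩ := hB
  refine ⟨Set.image2 (· + ·) U V, ?_⟩
  rw [Ideal.span_mul_span', ← Set.image2_mul, Set.image2_image_left, Set.image2_image_right,
    Set.image_image2]
  simp only [mon_mul_mon, Finsupp.coe_add]

theorem IsMonomialIdeal.prod {ι : Type*} (s : Finset ι)
    {J : ι → Ideal (MvPowerSeries (Fin n) k)} (h : ∀ i, IsMonomialIdeal (J i)) :
    IsMonomialIdeal (∏ i ∈ s, J i) := by
  classical
  induction s using Finset.induction_on with
  | empty =>
    rw [isMonomialIdeal_iff]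
    exact ⟨{0}, by simp [mon, Ideal.one_eq_top]⟩
  | insert i s hi ih =>
    rw [Finset.prod_insert hi]
    exact (h i).mul ih

theorem IsMonomialIdeal.frobPow (p : ℕ) [ExpChar (MvPowerSeries (Fin n) k) p] (a : ℕ)
    {J : Ideal (MvPowerSeries (Fin n) k)} (hJ : IsMonomialIdeal J) :
    IsMonomialIdeal (frobPow (p ^ a) J) := by
  rw [isMonomialIdeal_iff] at *
  obtain ⟨U, rfl⟩ := hJ
  refine ⟨(fun d => p ^ a • d) '' U, ?_⟩
  simp only [frobPow_pow_eq_map, Ideal.map_span, Set.image_image, iterateFrobenius_def, mon_pow,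
    Finsupp.coe_smul]

theorem IsMonomialIdeal.mem_colon_iff {A B : Ideal (MvPowerSeries (Fin n) k)}
    (hB : IsMonomialIdeal B) (f : MvPowerSeries (Fin n) k) :
    f ∈ A.colon (B : Set (MvPowerSeries (Fin n) k)) ↔
      ∀ u : Fin n →₀ ℕ, mon k u ∈ B → f * mon k u ∈ A := by
  rw [← Ideal.span_singleton_le_iff_mem, Ideal.le_colon_iff_mul_le, hB.eq_span,
    Ideal.span_mul_span', Ideal.span_le, Set.singleton_mul]
  simp only [Set.image_image, Set.image_subset_iff, ← hB.eq_span]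
  rfl

theorem IsMonomialIdeal.mul_mon_mem_iff {A : Ideal (MvPowerSeries (Fin n) k)}
    (hA : IsMonomialIdeal A) (f : MvPowerSeries (Fin n) k) (u : Fin n →₀ ℕ) :
    f * mon k u ∈ A ↔ ∀ d, coeff d f ≠ 0 → mon k (d + u) ∈ A := by
  rw [hA]
  constructor
  · intro h d hd
    refine h (d + u) ?_
    rwa [mon_eq_monomial, coeff_add_mul_monomial, mul_one]
  · intro h d hd
    rw [mon_eq_monomial, coeff_mul_monomial] at hd
    split_ifs at hd with hud
    · rw [mul_one] at hd
      have := h _ hd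
      rwa [tsub_add_cancel_of_le hud] at this
    · exact absurd rfl hd

theorem IsMonomialIdeal.colon {A B : Ideal (MvPowerSeries (Fin n) k)}
    (hA : IsMonomialIdeal A) (hB : IsMonomialIdeal B) :
    IsMonomialIdeal (A.colon (B : Set (MvPowerSeries (Fin n) k))) := by
  intro f
  simp only [hB.mem_colon_iff, mon_mul_mon, hA.mul_mon_mem_iff]
  exact ⟨fun h d hd u hu => h u hu d hd, fun h u hu d hd => h d hd u hu⟩

theorem faceIdeal_eq_span (α : Fin n → ℕ) :
    faceIdeal k α = Ideal.span ((fun d : Fin n →₀ ℕ => mon k d) ''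
      ((fun i => Finsupp.single i 1) '' {i | α i = 1})) := by
  rw [Set.image_image, faceIdeal]
  congr 1
  ext f
  simp [mon_eq_monomial, X, eq_comm]

theorem isMonomialIdeal_faceIdeal (α : Fin n → ℕ) : IsMonomialIdeal (faceIdeal k α) :=
  isMonomialIdeal_iff.2 ⟨_, faceIdeal_eq_span α⟩

theorem mon_mem_faceIdeal_iff (α : Fin n → ℕ) (d : Fin n →₀ ℕ) :
    mon k d ∈ faceIdeal k α ↔ ∃ i, α i = 1 ∧ d i ≠ 0 := by
  rw [faceIdeal_eq_span, mon_mem_span_mon_iff]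
  simp [Nat.one_le_iff_ne_zero]

theorem isMonomialIdeal_iInf_faceIdeal {r : ℕ} (α : Fin r → Fin n → ℕ) :
    IsMonomialIdeal (⨅ j, faceIdeal k (α j)) :=
  .iInf fun j => isMonomialIdeal_faceIdeal (α j)

theorem mon_one_pow_mem_colon {r : ℕ} (α : Fin r → Fin n → ℕ) {q : ℕ} (hq : 0 < q) :
    mon k (fun _ : Fin n => 1) ^ (q - 1) ∈ (frobPow q (⨅ j, faceIdeal k (α j))).colon
      ((⨅ j, faceIdeal k (α j) : Ideal (MvPowerSeries (Fin n) k)) :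
        Set (MvPowerSeries (Fin n) k)) := by
  rw [(isMonomialIdeal_iInf_faceIdeal α).mem_colon_iff]
  intro u hu
  let v : Fin n →₀ ℕ := u.mapRange (min 1) (by simp)
  have hv : mon k v ∈ ⨅ j, faceIdeal k (α j) := by
    simp only [Submodule.mem_iInf, mon_mem_faceIdeal_iff] at hu ⊢
    intro j
    obtain ⟨i, hi, hui⟩ := hu j
    refine ⟨i, hi, ?_⟩
    simp only [v, Finsupp.mapRange_apply]
    omega
  have hmem : mon k v ^ q ∈ frobPow q (⨅ j, faceIdeal k (α j)) :=
    Ideal.subset_span ⟨_, hv, rfl⟩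
  refine Ideal.mem_of_dvd _ ?_ hmem
  rw [mon_pow, mon_pow, mon_mul_mon]
  refine mon_dvd_mon fun i => ?_
  simp only [v, Pi.smul_apply, Pi.add_apply, Finsupp.mapRange_apply, smul_eq_mul, mul_one]
  rcases Nat.eq_zero_or_pos (u i) with h | h
  · simp [h]
  · rw [min_eq_left h]
    omega

theorem mon_one_pow_mem_Lideal (p : ℕ) (hp : 0 < p) {r : ℕ} (α : Fin r → Fin n → ℕ) {e : ℕ}
    (he : 2 ≤ e) :
    mon k (fun _ : Fin n => 1) ^ (p ^ e - 1) ∈ Lideal p e (⨅ j, faceIdeal k (α j)) := by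
  refine colon_mul_frobPow_colon_le_Lideal p he _ ?_
  have hexp : p ^ e - 1 = (p ^ 1 - 1) + (p ^ (e - 1) - 1) * p ^ 1 := by
    have h1 : p ^ (e - 1) * p ^ 1 = p ^ e := by
      rw [← pow_add, Nat.sub_add_cancel (by omega)]
    have h2 : p ^ 1 ≤ p ^ e := Nat.pow_le_pow_right hp (by omega)
    rw [Nat.sub_mul, h1]
    have := Nat.pow_pos (n := 1) hp
    omega
  rw [hexp, pow_add, pow_mul]
  exact Ideal.mul_mem_mul (mon_one_pow_mem_colon α (Nat.pow_pos hp))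
    (Ideal.subset_span ⟨_, mon_one_pow_mem_colon α (Nat.pow_pos hp), rfl⟩)

theorem IsMonomialIdeal.Lideal (p : ℕ) [ExpChar (MvPowerSeries (Fin n) k) p] (e : ℕ)
    {J : Ideal (MvPowerSeries (Fin n) k)} (hJ : IsMonomialIdeal J) :
    IsMonomialIdeal (Lideal p e J) :=
  .iSup fun _ => .iSup fun _ => .iSup fun _ => .iSup fun _ =>
    .prod _ fun _ => ((hJ.frobPow p _).colon hJ).frobPow p _

theorem coeff_mul_of_coeff_eq_zero {f : MvPowerSeries (Fin n) k} {d : Fin n →₀ ℕ}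
    (hf : ∀ d' < d, coeff d' f = 0) (a : MvPowerSeries (Fin n) k) :
    coeff d (a * f) = constantCoeff a * coeff d f := by
  classical
  rw [coeff_mul, Finset.sum_eq_single (0, d)]
  · simp
  · rintro ⟨x, y⟩ hxy hne
    rw [Finset.HasAntidiagonal.mem_antidiagonal] at hxy
    rw [hf y, mul_zero]
    refine lt_of_le_of_ne (hxy ▸ le_add_self) ?_
    rintro rfl
    exact hne (by simpa using hxy)
  · simp

/-- Minimal monomials of `A` that do not occur in `B` and generate `A` modulo `B` form a
generating set of `A / B` of the least cardinality. -/
theorem muQuot_eq_card {A B : Ideal (MvPowerSeries (Fin n) k)} (G : Finset (Fin n →₀ ℕ))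
    (hA : ∀ f ∈ A, ∀ d ∈ G, ∀ d' < d, coeff d' f = 0) (hB : ∀ f ∈ B, ∀ d ∈ G, coeff d f = 0)
    (h : A = B ⊔ Ideal.span ((fun d : Fin n →₀ ℕ => mon k d) '' G)) :
    muQuot A B = G.card := by
  classical
  have hinj : Function.Injective fun d : Fin n →₀ ℕ => mon k d := fun d d' hd => by
    simp only [mon_eq_monomial] at hd
    have := congrArg (coeff d) hd
    rw [coeff_monomial_same, coeff_monomial] at this
    by_contra hne
    simp [hne] at this
  refine le_antisymm (Nat.sInf_le ⟨G.image fun d : Fin n →₀ ℕ => mon k d,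
    Finset.card_image_of_injective _ hinj, by rwa [Finset.coe_image]⟩)
    (le_csInf ⟨_, G.image fun d : Fin n →₀ ℕ => mon k d, rfl, by rwa [Finset.coe_image]⟩ ?_)
  rintro _ ⟨s, rfl, hs⟩
  let φ : MvPowerSeries (Fin n) k →ₗ[k] (G → k) := LinearMap.pi fun d => coeff d.1
  have hφ (f) (d : G) : φ f d = coeff d.1 f := rfl
  have hspan : ∀ g ∈ Ideal.span (s : Set (MvPowerSeries (Fin n) k)),
      φ g ∈ Submodule.span k (φ '' s) := by
    intro g hg
    induction hg using Submodule.span_induction with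
    | mem g hg => exact Submodule.subset_span ⟨g, hg, rfl⟩
    | zero => simp
    | add f g _ _ hf hg => rw [map_add]; exact Submodule.add_mem _ hf hg
    | smul a g hg ih =>
      have hgA : g ∈ A := hs ▸ Ideal.mem_sup_right hg
      have : φ (a • g) = constantCoeff a • φ g := by
        ext d
        rw [Pi.smul_apply, hφ, hφ, smul_eq_mul,
          coeff_mul_of_coeff_eq_zero (hA g hgA d d.2), smul_eq_mul]
      rw [this]
      exact Submodule.smul_mem _ _ ih
  have hmem : ∀ f ∈ A, φ f ∈ Submodule.span k (φ '' s) := by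
    intro f hf
    rw [hs] at hf
    obtain ⟨b, hb, g, hg, rfl⟩ := Submodule.mem_sup.1 hf
    have : φ b = 0 := funext fun d => hB b hb d d.2
    rw [map_add, this, zero_add]
    exact hspan g hg
  have htop : Submodule.span k (φ '' s) = ⊤ := by
    rw [eq_top_iff, ← (Pi.basisFun k G).span_eq, Submodule.span_le]
    rintro _ ⟨d, rfl⟩
    have : Pi.basisFun k G d = φ (mon k d.1) := by
      ext d'
      rw [hφ, mon_eq_monomial, coeff_monomial, Pi.basisFun_apply, Pi.single_apply]
      simp only [Subtype.coe_inj]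
    rw [this]
    refine hmem _ ?_
    rw [h]
    exact Ideal.mem_sup_right (Ideal.subset_span ⟨d.1, d.2, rfl⟩)
  calc G.card = Module.finrank k (G → k) := by simp
    _ = Module.finrank k (Submodule.span k ((s.image φ : Finset (G → k)) : Set (G → k))) := by
      rw [Finset.coe_image, htop, finrank_top]
    _ ≤ (s.image φ).card := finrank_span_finset_le_card _
    _ ≤ s.card := Finset.card_image_le

theorem muIdeal_eq_muQuot_bot {R : Type*} [CommRing R] (J : Ideal R) :
    muIdeal J = muQuot J ⊥ := by
  simp only [muIdeal, muQuot, bot_sup_eq, eq_comm]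

theorem IsMinGen.mon_notMem {J : Ideal (MvPowerSeries (Fin n) k)} {d d' : Fin n →₀ ℕ}
    (h : IsMinGen k J d) (hd : d' < d) : mon k d' ∉ J :=
  h.2 d' (fun i => hd.le i) fun he => hd.ne (DFunLike.coe_injective he)

theorem finite_setOf_isMinGen (J : Ideal (MvPowerSeries (Fin n) k)) :
    {d : Fin n →₀ ℕ | IsMinGen k J d}.Finite :=
  WellQuasiOrderedLE.finite_of_isAntichain fun _ hd _ hd' hne hle =>
    hd'.mon_notMem (lt_of_le_of_ne hle hne) hd.1

theorem exists_isMinGen_le {J : Ideal (MvPowerSeries (Fin n) k)} {d : Fin n →₀ ℕ}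
    (hd : mon k d ∈ J) : ∃ u : Fin n →₀ ℕ, u ≤ d ∧ IsMinGen k J u := by
  obtain ⟨u, hud, hu⟩ :=
    exists_minimal_le_of_wellFoundedLT (fun u : Fin n →₀ ℕ => mon k u ∈ J) d hd
  refine ⟨u, hud, hu.prop, fun δ hδ hne hmem => hne ?_⟩
  have h2 : u ≤ Finsupp.equivFunOnFinite.symm δ := hu.le_of_le hmem fun i => hδ i
  exact le_antisymm hδ h2

theorem Jideal_eq_span (q : ℕ) (I : Ideal (MvPowerSeries (Fin n) k)) :
    Jideal k q I = Ideal.span ((fun d : Fin n →₀ ℕ => mon k d) ''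
      {d | IsMinGen k ((frobPow q I).colon (I : Set (MvPowerSeries (Fin n) k))) d ∧
        mon k d ∉ frobPow q I ∧ mon k d ∉ Ideal.span {mon k (fun _ => 1) ^ (q - 1)}}) := by
  rw [Jideal]
  congr 1
  ext f
  constructor
  · rintro ⟨γ, hγ, rfl⟩
    exact ⟨Finsupp.equivFunOnFinite.symm γ, hγ, rfl⟩
  · rintro ⟨d, hd, rfl⟩
    exact ⟨d, hd, rfl⟩

end Monomial

theorem statement10 (p : ℕ) [Fact p.Prime] (k : Type*) [Field k] [CharP k p]
    (n : ℕ) (hn : 0 < n) (r : ℕ) (hr : 0 < r) (α : Fin r → Fin n → ℕ)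
    (I : Ideal (MvPowerSeries (Fin n) k)) (hdec : IsMinFaceDecomp k α I)
    (hsum : (⨆ j, faceIdeal k (α j)) =
      Ideal.span (Set.range (MvPowerSeries.X : Fin n → MvPowerSeries (Fin n) k)))
    (e : ℕ) (he : 2 ≤ e) (hJ : Jideal k (p ^ e) I ≠ ⊥)
    (h : ∀ γ : Fin n → ℕ, IsMinGen k (Jideal k (p ^ e) I) γ → mon k γ ∉ Lideal p e I) :
    muQuot ((frobPow (p ^ e) I).colon I) (Lideal p e I ⊔ frobPow (p ^ e) I) =
      muIdeal (Jideal k (p ^ e) I) := by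
  have : CharP (MvPowerSeries (Fin n) k) p :=
    charP_of_injective_ringHom (f := MvPowerSeries.C) MvPowerSeries.C_injective p
  have hp : p.Prime := Fact.out
  obtain ⟨-, -, rfl, -⟩ := hdec
  have hI := isMonomialIdeal_iInf_faceIdeal (k := k) α
  have hx := mon_one_pow_mem_Lideal (k := k) p hp.pos α he
  generalize (⨅ j, faceIdeal k (α j)) = I at *
  have hF := hI.frobPow p e
  have hK := hF.colon hI
  have hL := hI.Lideal p e
  have hLK := Lideal_le_colon p e I
  have hJG := Jideal_eq_span (p ^ e) I
  set K := (frobPow (p ^ e) I).colon (I : Set (MvPowerSeries (Fin n) k))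
  set J := Jideal k (p ^ e) I
  have hfin : {d : Fin n →₀ ℕ | IsMinGen k K d ∧ mon k d ∉ frobPow (p ^ e) I ∧
      mon k d ∉ Ideal.span {mon k (fun _ => 1) ^ (p ^ e - 1)}}.Finite :=
    (finite_setOf_isMinGen K).subset fun d hd => hd.1
  obtain ⟨G, hG⟩ := hfin.exists_finset
  have hG' : (G : Set (Fin n →₀ ℕ)) = _ := Set.ext hG
  rw [← hG'] at hJG
  have hJK : J ≤ K := by
    rw [hJG, Ideal.span_le]
    rintro _ ⟨d, hd, rfl⟩
    exact ((hG d).1 hd).1.1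
  have hlow : ∀ f ∈ K, ∀ d ∈ G, ∀ d' < d, MvPowerSeries.coeff d' f = 0 := by
    intro f hf d hd d' hlt
    by_contra hne
    exact ((hG d).1 hd).1.mon_notMem hlt ((hK f).1 hf d' hne)
  have hGL : ∀ d ∈ G, mon k d ∉ Lideal p e I := by
    intro d hd
    have hdJ : mon k d ∈ J := hJG ▸ Ideal.subset_span ⟨d, hd, rfl⟩
    exact h d ⟨hdJ, fun δ hδ hne hmem => ((hG d).1 hd).1.2 δ hδ hne (hJK hmem)⟩
  have hsup : K = Lideal p e I ⊔ frobPow (p ^ e) I ⊔ J := by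
    refine le_antisymm ?_ (sup_le (sup_le hLK Ideal.le_colon) hJK)
    rw [hK.eq_span, Ideal.span_le]
    rintro _ ⟨d, hd : mon k d ∈ K, rfl⟩
    obtain ⟨u, hud, hu⟩ := exists_isMinGen_le hd
    refine Ideal.mem_of_dvd _ (mon_dvd_mon hud) ?_
    by_cases h1 : mon k u ∈ frobPow (p ^ e) I
    · exact Ideal.mem_sup_left (Ideal.mem_sup_right h1)
    by_cases h2 : mon k u ∈ Ideal.span {mon k (fun _ : Fin n => 1) ^ (p ^ e - 1)}
    · exact Ideal.mem_sup_left (Ideal.mem_sup_left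
        ((Ideal.span_singleton_le_iff_mem _).2 hx h2))
    · refine Ideal.mem_sup_right ?_
      rw [hJG]
      exact Ideal.subset_span ⟨u, (hG u).2 ⟨hu, h1, h2⟩, rfl⟩
  rw [muIdeal_eq_muQuot_bot, muQuot_eq_card G hlow ?_ (hJG ▸ hsup),
    muQuot_eq_card G (fun f hf => hlow f (hJK hf)) ?_ (by rwa [bot_sup_eq])]
  · intro f hf d _
    rw [(Submodule.mem_bot _).1 hf, map_zero]
  · intro f hf d hd
    obtain ⟨a, ha, b, hb, rfl⟩ := Submodule.mem_sup.1 hf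
    have h1 : MvPowerSeries.coeff d a = 0 := by
      by_contra hne
      exact hGL d hd ((hL a).1 ha d hne)
    have h2 : MvPowerSeries.coeff d b = 0 := by
      by_contra hne
      exact ((hG d).1 hd).2.1 ((hF b).1 hb d hne)
    rw [map_add, h1, h2, add_zero]

end
end

section
/- Let (S, m) → (T, n) be a flat local extension of regular local rings of prime characteristic p and let I ⊆ S be an ideal. Then for every e ≥ 0 and q = p^e, μ_S((I^{[q]} :_S I)/(L_{e,S} + I^{[q]})) = μ_T(((IT)^{[q]} :_T IT)/(L_{e,T} + (IT)^{[q]})), where L_{e,S} and L_{e,T} are formed from the colon ideals K_{a,S} = (I^{[p^a]} :_S I) and K_{a,T} = ((IT)^{[p^a]} :_T IT) respectively. In other words, the complexity sequences satisfy c_{e,S/I} = c_{e,T/IT} for all e ≥ 0. -/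
noncomputable section

/-- A Noetherian local ring is regular if its maximal ideal can be generated by
`dim R` many elements. -/
def IsRegularLocal (R : Type*) [CommRing R] [IsLocalRing R] : Prop :=
  ∃ s : Finset R, Ideal.span (s : Set R) = IsLocalRing.maximalIdeal R ∧
    (s.card : WithBot ℕ∞) = ringKrullDim R

/-- The Frobenius power is the extension of the ideal along the iterated Frobenius. -/
lemma frobPow_eq_map_iterateFrobenius {R : Type*} [CommRing R] (p n : ℕ) [ExpChar R p]
    (I : Ideal R) : frobPow (p ^ n) I = I.map (iterateFrobenius R p n) := rfl

lemma map_frobPow {R R' : Type*} [CommRing R] [CommRing R'] (p n : ℕ) [ExpChar R p]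
    [ExpChar R' p] (f : R →+* R') (I : Ideal R) :
    (frobPow (p ^ n) I).map f = frobPow (p ^ n) (I.map f) := by
  rw [frobPow_eq_map_iterateFrobenius, frobPow_eq_map_iterateFrobenius, Ideal.map_map,
    Ideal.map_map]
  congr 1
  ext x
  exact f.map_iterateFrobenius p x n

/-- Colon ideals by finitely generated ideals commute with flat base change. -/
lemma Ideal.map_colon_of_flat {R R' : Type*} [CommRing R] [CommRing R'] [Algebra R R']
    [Module.Flat R R'] {J I : Ideal R} (hJ : J.FG) (hI : I.FG) :
    (J.colon (I : Set R)).map (algebraMap R R') =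
      (J.map (algebraMap R R')).colon (I.map (algebraMap R R') : Set R') := by
  apply le_antisymm
  · rw [Ideal.map_le_iff_le_comap]
    intro x hx
    rw [Submodule.mem_colon] at hx
    rw [Ideal.mem_comap, Submodule.mem_colon]
    intro y hy
    induction hy using Submodule.span_induction with
    | mem y hy =>
      obtain ⟨z, hz, rfl⟩ := hy
      rw [smul_eq_mul, ← map_mul]
      exact Ideal.mem_map_of_mem _ (hx z hz)
    | zero => simp
    | add y z _ _ hy hz => rw [smul_add]; exact add_mem hy hz
    | smul a y _ hy => rw [smul_comm]; exact Submodule.smul_mem _ a hy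
  · intro t ht
    rw [Submodule.mem_colon] at ht
    obtain ⟨m, a, ha⟩ := Submodule.fg_iff_exists_fin_generating_family.mp hJ
    obtain ⟨n, b, hb⟩ := Submodule.fg_iff_exists_fin_generating_family.mp hI
    have hbI (i) : b i ∈ I := hb ▸ Submodule.subset_span (Set.mem_range_self i)
    have haJ (j) : a j ∈ J := ha ▸ Submodule.subset_span (Set.mem_range_self j)
    have key (i : Fin n) : ∃ c : Fin m → R', ∑ j, c j * algebraMap R R' (a j) =
        t * algebraMap R R' (b i) := by
      have h := ht _ (Ideal.mem_map_of_mem (algebraMap R R') (hbI i))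
      have hJmap : J.map (algebraMap R R') =
          Submodule.span R' (Set.range (algebraMap R R' ∘ a)) := by
        rw [← ha, ← Ideal.span, Ideal.map_span, Set.range_comp]
      rw [hJmap, Submodule.mem_span_range_iff_exists_fun] at h
      simpa using h
    choose c hc using key
    let f : (Fin n → R) →ₗ[R] (R × (Fin n → Fin m → R)) :=
      Fintype.linearCombination R fun i =>
        b i • (1, 0) - ∑ j, a j • (0, Pi.single i (Pi.single j 1))
    let x : (R × (Fin n → Fin m → R)) →ₗ[R] R' :=
      LinearMap.coprod (LinearMap.toSpanSingleton R R' t)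
        (LinearMap.lsum R _ R fun i => Fintype.linearCombination R (c i))
    have hxf : x ∘ₗ f = 0 := by
      refine LinearMap.pi_ext' fun i => LinearMap.ext_ring ?_
      have hxi (j : Fin m) : x (0, Pi.single i (Pi.single j 1)) = c i j := by
        simp [x, Pi.single_apply, apply_ite, Fintype.linearCombination_apply]
      have hx0 : x (1, 0) = t := by simp [x]
      have h : x (b i • (1, 0) - ∑ j, a j • (0, Pi.single i (Pi.single j 1))) = 0 := by
        rw [map_sub, map_sum]
        simp only [map_smul, hxi, hx0]
        simp only [Algebra.smul_def]
        rw [sub_eq_zero, mul_comm, ← hc i]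
        exact Finset.sum_congr rfl fun j _ => mul_comm _ _
      simpa [f, Fintype.linearCombination_apply_single] using h
    obtain ⟨k, g, y, hxy, hgf⟩ := Module.Flat.exists_factorization_of_comp_eq_zero_of_free hxf
    have hcol (l : Fin k) : g (1, 0) l ∈ J.colon (I : Set R) := by
      have hle : I ≤ J.colon {g (1, 0) l} := by
        rw [← hb, Submodule.span_le]
        rintro _ ⟨i, rfl⟩
        have h := DFunLike.congr_fun (LinearMap.congr_fun hgf (Pi.single i 1)) l
        simp only [LinearMap.comp_apply, f, Fintype.linearCombination_apply_single, one_smul,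
          map_sub, map_sum, map_smul, LinearMap.zero_apply, Finsupp.sub_apply,
          Finsupp.finsetSum_apply, Finsupp.smul_apply, Finsupp.zero_apply, sub_eq_zero] at h
        rw [SetLike.mem_coe, Submodule.mem_colon_singleton, h]
        exact J.sum_mem fun j _ => Ideal.mul_mem_right _ _ (haJ j)
      refine Submodule.mem_colon.mpr fun z hz => ?_
      have := Submodule.mem_colon_singleton.mp (hle hz)
      rwa [smul_eq_mul, mul_comm] at this
    have ht' : t = y (g (1, 0)) := by
      rw [← LinearMap.comp_apply, ← hxy]
      simp [x]
    rw [ht', ← Finsupp.univ_sum_single (g (1, 0)), map_sum]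
    refine Ideal.sum_mem _ fun l _ => ?_
    rw [← mul_one (g (1, 0) l), ← smul_eq_mul, ← Finsupp.smul_single, map_smul, Algebra.smul_def]
    exact Ideal.mul_mem_right _ _ (Ideal.mem_map_of_mem _ (hcol l))

lemma map_Lideal {R R' : Type*} [CommRing R] [CommRing R'] [IsNoetherianRing R] [Algebra R R']
    [Module.Flat R R'] (p e : ℕ) [ExpChar R p] [ExpChar R' p] (I : Ideal R) :
    (Lideal p e I).map (algebraMap R R') = Lideal p e (I.map (algebraMap R R')) := by
  simp only [Lideal, Ideal.map_iSup]
  congr! 8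
  rw [← Ideal.mapHom_apply, map_prod]
  simp only [Ideal.mapHom_apply, map_frobPow,
    Ideal.map_colon_of_flat (IsNoetherian.noetherian _) (IsNoetherian.noetherian _)]

/-- Over a local ring, a finite generating set of `A` modulo `B` contains a generating set that is
no larger than any other given one. -/
lemma exists_subset_card_le_of_sup_span {R : Type*} [CommRing R] [IsLocalRing R]
    {A B : Ideal R} {s t : Finset R} (hs : A = B ⊔ Ideal.span s) (ht : A = B ⊔ Ideal.span t) :
    ∃ s' ⊆ s, s'.card ≤ t.card ∧ A = B ⊔ Ideal.span (s' : Set R) := by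
  classical
  obtain ⟨s', hs', hmin⟩ := (s.powerset.filter
    fun u : Finset R => A = B ⊔ Ideal.span (u : Set R)).exists_min_image Finset.card
      ⟨s, by simpa using hs⟩
  simp only [Finset.mem_filter, Finset.mem_powerset] at hs' hmin
  refine ⟨s', hs'.1, ?_, hs'.2⟩
  have hexp (u : Finset R) (hu : A = B ⊔ Ideal.span u) (x : R) (hx : x ∈ A) :
      ∃ c : u → R, x - ∑ i, c i * i ∈ B := by
    rw [hu] at hx
    obtain ⟨y, hy, z, hz, rfl⟩ := Submodule.mem_sup.mp hx
    have : (u : Set R) = Set.range (fun i : u => (i : R)) := by simp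
    rw [this, Ideal.span, Submodule.mem_span_range_iff_exists_fun] at hz
    obtain ⟨c, rfl⟩ := hz
    exact ⟨c, by simpa using hy⟩
  have hsA (i : s') : (i : R) ∈ A := hs'.2 ▸ Ideal.mem_sup_right (Ideal.subset_span i.2)
  have htA (i : t) : (i : R) ∈ A := ht ▸ Ideal.mem_sup_right (Ideal.subset_span i.2)
  choose P hP using fun i : s' => hexp t ht i (hsA i)
  choose Q hQ using fun i : t => hexp s' hs'.2 i (htA i)
  have hindep (c : s' → R) (hc : ∑ i, c i * i ∈ B) (i : s') :
      IsLocalRing.residue R (c i) = 0 := by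
    by_contra hne
    rw [← ne_eq, IsLocalRing.residue_ne_zero_iff_isUnit] at hne
    obtain ⟨d, hd⟩ := hne.exists_left_inv
    have hgen : A = B ⊔ Ideal.span ((s'.erase i : Finset R) : Set R) := by
      apply le_antisymm
      · conv_lhs => rw [hs'.2]
        refine sup_le le_sup_left (Ideal.span_le.mpr fun x hx => ?_)
        by_cases hxi : x = i
        · rw [← Finset.add_sum_erase _ _ (Finset.mem_univ i)] at hc
          have h2 : ∑ j ∈ Finset.univ.erase i, c j * (j : R) ∈
              B ⊔ Ideal.span ((s'.erase i : Finset R) : Set R) :=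
            sum_mem fun j hj => Ideal.mul_mem_left _ _ <| Ideal.mem_sup_right <|
              Ideal.subset_span <| Finset.mem_coe.mpr <|
                Finset.mem_erase.mpr
                  ⟨fun h => Finset.ne_of_mem_erase hj (Subtype.ext h), j.2⟩
          have h3 := Ideal.mul_mem_left _ d
            ((Submodule.add_mem_iff_left _ h2).mp (Ideal.mem_sup_left hc))
          rw [← mul_assoc, hd, one_mul] at h3
          rwa [hxi]
        · exact Ideal.mem_sup_right (Ideal.subset_span (by simpa [hxi] using hx))
      · conv_rhs => rw [hs'.2]
        exact sup_le_sup_left (Ideal.span_mono (by simp)) _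
    have := hmin _ ⟨(Finset.erase_subset _ _).trans hs'.1, hgen⟩
    exact absurd (Finset.card_erase_lt_of_mem i.2) this.not_gt
  have hPQ : (Matrix.of P * Matrix.of Q).map (IsLocalRing.residue R) = 1 := by
    ext i j
    have hmem : ∑ j : s', (Matrix.of P * Matrix.of Q - 1 : Matrix s' s' R) i j * (j : R) ∈ B := by
      have h := add_mem (hP i) (sum_mem fun k (_ : k ∈ Finset.univ) =>
        Ideal.mul_mem_left _ (P i k) (hQ k))
      have := neg_mem h
      convert this using 1
      simp only [Matrix.sub_apply, Matrix.mul_apply, Matrix.of_apply, sub_mul, mul_sub,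
        Finset.sum_sub_distrib, Finset.sum_mul, Finset.mul_sum, Matrix.one_apply]
      rw [Finset.sum_comm]
      simp [mul_assoc]
    have h := hindep _ hmem j
    rw [Matrix.sub_apply, map_sub, sub_eq_zero] at h
    rw [Matrix.map_apply, h]
    simp [Matrix.one_apply, apply_ite]
  rw [Matrix.map_mul] at hPQ
  have hrank := Matrix.rank_mul_le_left ((Matrix.of P).map (IsLocalRing.residue R))
    ((Matrix.of Q).map (IsLocalRing.residue R))
  rw [hPQ, Matrix.rank_one] at hrank
  simpa using hrank.trans (Matrix.rank_le_card_width _)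

lemma muQuot_eq_zero_of_not_le {R : Type*} [CommRing R] {A B : Ideal R} (h : ¬ B ≤ A) :
    muQuot A B = 0 := by
  have : {c | ∃ s : Finset R, s.card = c ∧ A = B ⊔ Ideal.span (s : Set R)} = ∅ :=
    Set.eq_empty_of_forall_notMem fun _ ⟨_, _, hs⟩ => h (hs ▸ le_sup_left)
  rw [muQuot, this, Nat.sInf_empty]

/-- The minimal number of generators of `A / B` is invariant under flat local extensions. -/
lemma muQuot_map {S T : Type*} [CommRing S] [CommRing T] [IsNoetherianRing S]
    [IsLocalRing S] [IsLocalRing T] [Algebra S T] [Module.Flat S T]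
    [IsLocalHom (algebraMap S T)] (A B : Ideal S) :
    muQuot (A.map (algebraMap S T)) (B.map (algebraMap S T)) = muQuot A B := by
  classical
  have : Module.FaithfullyFlat S T := .of_flat_of_isLocalHom
  have hmap : Function.Injective (Ideal.map (algebraMap S T)) :=
    Function.LeftInverse.injective (g := Ideal.comap (algebraMap S T))
      fun I => I.comap_map_eq_self_of_faithfullyFlat
  have hspan (s : Finset S) : (B ⊔ Ideal.span (s : Set S)).map (algebraMap S T) =
      B.map (algebraMap S T) ⊔ Ideal.span ((s.image (algebraMap S T) : Finset T) : Set T) := by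
    rw [Ideal.map_sup, Ideal.map_span, Finset.coe_image]
  have hinj : Function.Injective (algebraMap S T) := FaithfulSMul.algebraMap_injective S T
  have himage {s : Finset S} (hs : A = B ⊔ Ideal.span (s : Set S)) :
      A.map (algebraMap S T) = B.map (algebraMap S T) ⊔
        Ideal.span ((s.image (algebraMap S T) : Finset T) : Set T) := by
    rw [← hspan, ← hs]
  by_cases hBA : B ≤ A
  · obtain ⟨g, hg⟩ := (isNoetherianRing_iff_ideal_fg S).mp inferInstance A
    have hne : A = B ⊔ Ideal.span (g : Set S) := by rw [hg, sup_eq_right.mpr hBA]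
    obtain ⟨s, hsc, hs⟩ := Nat.sInf_mem
      (s := {c | ∃ s : Finset S, s.card = c ∧ A = B ⊔ Ideal.span (s : Set S)}) ⟨_, g, rfl, hne⟩
    obtain ⟨t, htc, ht⟩ := Nat.sInf_mem
      (s := {c | ∃ s : Finset T, s.card = c ∧ A.map (algebraMap S T) =
        B.map (algebraMap S T) ⊔ Ideal.span (s : Set T)}) ⟨_, _, rfl, himage hne⟩
    apply le_antisymm
    · have hle : muQuot _ _ ≤ _ := Nat.sInf_le ⟨_, rfl, himage hs⟩
      exact hle.trans (Finset.card_image_le.trans hsc.le)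
    · obtain ⟨s', hs's, hcard, hs'⟩ := exists_subset_card_le_of_sup_span (himage hs) ht
      obtain ⟨u, -, rfl⟩ := Finset.subset_image_iff.mp hs's
      rw [Finset.card_image_of_injective _ hinj] at hcard
      rw [← hspan] at hs'
      have hle : muQuot A B ≤ _ := Nat.sInf_le ⟨u, rfl, hmap hs'⟩
      exact hle.trans (hcard.trans htc.le)
  · have hBA' : ¬ B.map (algebraMap S T) ≤ A.map (algebraMap S T) := fun h => hBA <| by
      rw [Ideal.map_le_iff_le_comap, Ideal.comap_map_eq_self_of_faithfullyFlat] at h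
      exact h
    rw [muQuot_eq_zero_of_not_le hBA, muQuot_eq_zero_of_not_le hBA']

theorem statement14 (p : ℕ) [Fact p.Prime] (S T : Type*) [CommRing S] [CommRing T]
    [IsNoetherianRing S] [IsNoetherianRing T] [IsLocalRing S] [IsLocalRing T]
    [CharP S p] [CharP T p] (hSreg : IsRegularLocal S) (hTreg : IsRegularLocal T)
    [Algebra S T] [Module.Flat S T] (hloc : IsLocalHom (algebraMap S T))
    (I : Ideal S) (e : ℕ) :
    muQuot ((frobPow (p ^ e) I).colon I) (Lideal p e I ⊔ frobPow (p ^ e) I) =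
      muQuot ((frobPow (p ^ e) (I.map (algebraMap S T))).colon (I.map (algebraMap S T)))
        (Lideal p e (I.map (algebraMap S T)) ⊔
          frobPow (p ^ e) (I.map (algebraMap S T))) := by
  have := hloc
  have : ExpChar S p := .prime Fact.out
  have : ExpChar T p := .prime Fact.out
  rw [← muQuot_map (T := T), Ideal.map_sup, map_Lideal, map_frobPow,
    Ideal.map_colon_of_flat (IsNoetherian.noetherian _) (IsNoetherian.noetherian _), map_frobPow]

end
end
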